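/- Fix α ∈ ℝ, a unit vector b ∈ ℂⁿ (b†b = 1), and pairwise distinct κ₁, …, κ_N > 0 with |α| < κⱼ for every j (equivalently f_α(iκⱼ) = (α+κⱼ)/(α−κⱼ) < 0). Define the pure imaginary spectral parameters λⱼ = iκⱼ and the norming vectors b̃ⱼ = ( √(−f_α(iκⱼ)) )^{(−1)^N} · b, and let r be given by the N-soliton determinant formula with data {(b̃ⱼ, iκⱼ)}_{j=1}^N; assume det M(x,t) ≠ 0 for all x ≥ 0 and t ∈ ℝ. Then r solves the VNLS equation on the half-line x ≥ 0 and satisfies the homogeneous vector Robin boundary condition ∂ₓr(0,t) = 2α r(0,t) for all t ∈ ℝ; these are N stationary (boundary-bound) solitons. -/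

import Mathlib

open Complex Matrix

noncomputable section

def pdx (f : ℝ × ℝ → ℂ) : ℝ × ℝ → ℂ := fun p => deriv (fun x => f (x, p.2)) p.1

def pdt (f : ℝ × ℝ → ℂ) : ℝ × ℝ → ℂ := fun p => deriv (fun t => f (p.1, t)) p.2

/-- The focusing vector NLS equation `i rₜ + rₓₓ + 2 (r†r) r = 0` at a point. -/
def VNLS {n : ℕ} (r : ℝ × ℝ → Fin n → ℂ) (p : ℝ × ℝ) : Prop :=
  ∀ ℓ : Fin n, Complex.I * pdt (fun q => r q ℓ) p + pdx (pdx (fun q => r q ℓ)) p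
      + 2 * (∑ j, (starRingEnd ℂ) (r p j) * r p j) * r p ℓ = 0

/-- `βⱼ(x,t) = e^{−2i(λⱼx + 2λⱼ²t)} bⱼ`. -/
def solBeta {ι : Type*} {n : ℕ} (lam : ι → ℂ) (b : ι → Fin n → ℂ) (p : ℝ × ℝ) (j : ι) :
    Fin n → ℂ :=
  fun ℓ => Complex.exp (-2 * Complex.I * (lam j * p.1 + 2 * (lam j) ^ 2 * p.2)) * b j ℓ

/-- `M_{jk} = (β_k†βⱼ + 1)/(λⱼ* − λ_k)`. -/
def solM {ι : Type*} [Fintype ι] {n : ℕ} (lam : ι → ℂ) (b : ι → Fin n → ℂ) (p : ℝ × ℝ) :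
    Matrix ι ι ℂ :=
  Matrix.of fun j k =>
    ((∑ ℓ, (starRingEnd ℂ) (solBeta lam b p k ℓ) * solBeta lam b p j ℓ) + 1)
      / ((starRingEnd ℂ) (lam j) - lam k)

/-- The bordered matrix `B_ℓ` with corner `0`, first row `(0,1,…,1)`,
first column `(β_{j;ℓ})` and lower-right block `M`. -/
def solB {ι : Type*} [Fintype ι] {n : ℕ} (lam : ι → ℂ) (b : ι → Fin n → ℂ)
    (ℓ : Fin n) (p : ℝ × ℝ) : Matrix (Option ι) (Option ι) ℂ :=
  Matrix.of fun i j =>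
    match i, j with
    | none, none => 0
    | none, some _ => 1
    | some i', none => solBeta lam b p i' ℓ
    | some i', some j' => solM lam b p i' j'

/-- The `N`-soliton determinant formula `r_ℓ = (2i/det M) det B_ℓ`. -/
def solR {ι : Type*} [Fintype ι] [DecidableEq ι] {n : ℕ} (lam : ι → ℂ)
    (b : ι → Fin n → ℂ) (p : ℝ × ℝ) (ℓ : Fin n) : ℂ :=
  (2 * Complex.I / (solM lam b p).det) * (solB lam b ℓ p).det

def fRobin (α : ℝ) (lam : ℂ) : ℂ := (Complex.I * α + lam) / (Complex.I * α - lam)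

/-- Homogeneous vector Robin boundary condition `rₓ(0,t) = 2α r(0,t)` for all `t`. -/
def RobinBC {n : ℕ} (α : ℝ) (r : ℝ × ℝ → Fin n → ℂ) : Prop :=
  ∀ (t : ℝ) (ℓ : Fin n), pdx (fun q => r q ℓ) (0, t) = 2 * (α : ℂ) * r (0, t) ℓ

section BoundSolitons

variable {ι : Type*} [Fintype ι] [DecidableEq ι]

/-- The symmetric Cauchy matrix with entries `1 / (κⱼ + κₖ)`. -/
def cauchyGram {F : Type*} [Field F] (κ : ι → F) : Matrix ι ι F :=
  Matrix.of fun j k => (κ j + κ k)⁻¹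

theorem isUnit_det_cauchyGram {F : Type*} [Field F] {κ : ι → F} (hκ : ∀ j k, κ j + κ k ≠ 0)
    (hinj : Function.Injective κ) : IsUnit (cauchyGram κ).det := by
  rw [isUnit_iff_ne_zero]
  intro hdet
  obtain ⟨x, hx, hQx⟩ := Matrix.exists_mulVec_eq_zero_iff.mpr hdet
  let p : Polynomial F := ∑ k, Polynomial.C (x k) *
    ∏ l ∈ Finset.univ.erase k, (Polynomial.X + Polynomial.C (κ l))
  have heval : ∀ z, p.eval z = ∑ k, x k * ∏ l ∈ Finset.univ.erase k, (z + κ l) := by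
    intro z
    simp [p, Polynomial.eval_finsetSum, Polynomial.eval_prod]
  have hp : p = 0 := by
    refine Polynomial.eq_zero_of_degree_lt_of_eval_index_eq_zero (s := Finset.univ) (v := κ)
      hinj.injOn ?_ ?_
    · refine (Polynomial.degree_sum_le _ _).trans_lt ?_
      rw [Finset.sup_lt_iff (by simp)]
      intro k _
      refine (Polynomial.degree_mul_le _ _).trans_lt ?_
      rw [Polynomial.degree_prod]
      simp only [Polynomial.degree_X_add_C, Finset.sum_const, Finset.card_erase_of_mem
        (Finset.mem_univ k)]
      refine (add_le_add_left Polynomial.degree_C_le _).trans_lt ?_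
      have : 0 < (Finset.univ : Finset ι).card := Finset.card_pos.mpr ⟨k, Finset.mem_univ k⟩
      simp only [zero_add, nsmul_eq_mul, mul_one]
      exact_mod_cast Nat.sub_lt this one_pos
    · intro j _
      have h := congrFun hQx j
      simp only [cauchyGram, Matrix.mulVec, dotProduct, Matrix.of_apply, Pi.zero_apply] at h
      rw [heval, ← mul_zero (∏ l, (κ j + κ l)), ← h, Finset.mul_sum]
      refine Finset.sum_congr rfl fun k _ => ?_
      rw [← Finset.mul_prod_erase _ _ (Finset.mem_univ k)]
      field_simp [hκ j k]
  refine hx (funext fun k => ?_)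
  have h := heval (-κ k)
  rw [hp, Polynomial.eval_zero, Finset.sum_eq_single k] at h
  · refine (mul_eq_zero.mp h.symm).resolve_right (Finset.prod_ne_zero_iff.mpr fun l hl => ?_)
    rw [neg_add_eq_sub, sub_ne_zero]
    exact fun h => (Finset.ne_of_mem_erase hl) (hinj h)
  · intro m _ hm
    rw [Finset.prod_eq_zero (i := k) (by simp [hm.symm]) (by simp), mul_zero]
  · simp

omit [Fintype ι] [DecidableEq ι] in
theorem cauchyGram_transpose {F : Type*} [Field F] (κ : ι → F) :
    (cauchyGram κ)ᵀ = cauchyGram κ := by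
  ext j k
  simp [cauchyGram, add_comm]

theorem diagonal_mul_cauchyGram_add {F : Type*} [Field F] {κ : ι → F}
    (hκ : ∀ j k, κ j + κ k ≠ 0) :
    diagonal κ * cauchyGram κ + cauchyGram κ * diagonal κ = vecMulVec 1 1 := by
  ext j k
  have := hκ j k
  simp only [cauchyGram, Matrix.add_apply, Matrix.diagonal_mul, Matrix.mul_diagonal,
    Matrix.of_apply, vecMulVec_apply, Pi.one_apply]
  field_simp

/-- The solution `y` of `Q y = 1` for the Cauchy matrix `Q` makes `diag(y) Q` an involution. -/
theorem exists_cauchyGram_involution {F : Type*} [Field F] {κ : ι → F}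
    (hκ : ∀ j k, κ j + κ k ≠ 0) (hκ0 : ∀ j, κ j ≠ 0) (hinj : Function.Injective κ) :
    ∃ y : ι → F, (∀ j, y j ≠ 0) ∧ (∀ j, ∑ k, y k / (κ j + κ k) = 1) ∧
      (∀ j l, ∑ k, y j / (κ j + κ k) * (y k / (κ k + κ l)) = if j = l then 1 else 0) ∧
      ∑ k, y k / κ k = 1 - (-1) ^ Fintype.card ι ∧ ∑ k, y k = 2 * ∑ k, κ k := by
  set Q := cauchyGram κ with hQ
  have hu : IsUnit Q.det := isUnit_det_cauchyGram hκ hinj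
  set R := Q⁻¹ with hR
  have hQR : Q * R = 1 := Matrix.mul_nonsing_inv _ hu
  have hRQ : R * Q = 1 := Matrix.nonsing_inv_mul _ hu
  have hRT : Rᵀ = R := by rw [hR, Matrix.transpose_nonsing_inv, cauchyGram_transpose]
  have hS := diagonal_mul_cauchyGram_add hκ
  rw [← hQ] at hS
  have hQy : Q *ᵥ (R *ᵥ 1) = 1 := by rw [Matrix.mulVec_mulVec, hQR, Matrix.one_mulVec]
  have hRS : R * diagonal κ + diagonal κ * R = vecMulVec (R *ᵥ 1) (R *ᵥ 1) := by
    have h : R * (diagonal κ * Q + Q * diagonal κ) * R = R * vecMulVec 1 1 * R := by rw [hS]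
    rw [Matrix.mul_vecMulVec, Matrix.vecMulVec_mul, ← Matrix.mulVec_transpose, hRT] at h
    rw [← h, Matrix.mul_add, Matrix.add_mul]
    congr 1
    · rw [Matrix.mul_assoc, Matrix.mul_assoc, hQR, Matrix.mul_one]
    · rw [← Matrix.mul_assoc, hRQ, Matrix.one_mul]
  have hRe : ∀ j k, R j k = (R *ᵥ 1) j * (R *ᵥ 1) k / (κ j + κ k) := by
    intro j k
    have h := congrFun (congrFun hRS j) k
    simp only [Matrix.add_apply, Matrix.diagonal_mul, Matrix.mul_diagonal, vecMulVec_apply] at h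
    rw [← h, eq_div_iff (hκ j k)]
    ring
  have hRQe : ∀ j l, ∑ k, R j k * (κ k + κ l)⁻¹ = if j = l then 1 else 0 := by
    intro j l
    rw [← Matrix.one_apply, ← hRQ, Matrix.mul_apply]
    rfl
  refine ⟨R *ᵥ 1, ?_, ?_, ?_, ?_, ?_⟩
  · intro j hj
    have h := hRQe j j
    simp only [hRe, hj, zero_mul, zero_div, Finset.sum_const_zero, if_true] at h
    exact zero_ne_one h
  · intro j
    have h := congrFun hQy j
    rw [Pi.one_apply] at h
    rw [← h]
    exact Finset.sum_congr rfl fun k _ => div_eq_inv_mul _ _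
  · intro j l
    rw [← hRQe j l]
    refine Finset.sum_congr rfl fun k _ => ?_
    rw [hRe]
    ring
  · have h1 : Q + replicateCol Unit (fun j => -(κ j)⁻¹) * replicateRow Unit (1 : ι → F)
        = diagonal (fun j => -(κ j)⁻¹) * Q * diagonal κ := by
      ext j k
      have := hκ j k
      have := hκ0 j
      rw [Matrix.mul_diagonal, Matrix.diagonal_mul]
      simp only [hQ, cauchyGram, Matrix.add_apply, Matrix.mul_apply, Matrix.replicateCol_apply,
        Matrix.replicateRow_apply, Matrix.of_apply,
        Finset.univ_unique, Finset.sum_singleton, Pi.one_apply]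
      field_simp
      ring
    have h2 := congrArg Matrix.det h1
    rw [Matrix.det_add_replicateCol_mul_replicateRow hu, Matrix.det_mul, Matrix.det_mul,
      Matrix.det_diagonal, Matrix.det_diagonal, mul_right_comm, ← Finset.prod_mul_distrib,
      mul_comm] at h2
    have h3 := mul_right_cancel₀ (isUnit_iff_ne_zero.mp hu) h2
    have h4 : ∏ j, (-(κ j)⁻¹ * κ j) = (-1) ^ Fintype.card ι := by
      rw [Finset.prod_congr rfl fun j _ => by rw [neg_mul, inv_mul_cancel₀ (hκ0 j)],
        Finset.prod_const, Finset.card_univ]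
    have h5 : replicateRow Unit (1 : ι → F) * R * replicateCol Unit (fun j => -(κ j)⁻¹)
        = replicateRow Unit (1 : ι → F) * replicateCol Unit (R *ᵥ fun j => -(κ j)⁻¹) := by
      rw [Matrix.mul_assoc, Matrix.replicateCol_mulVec]
    have h6 : (1 : ι → F) ⬝ᵥ (R *ᵥ fun j => -(κ j)⁻¹) = -∑ k, (R *ᵥ 1) k / κ k := by
      rw [Matrix.dotProduct_mulVec, ← Matrix.mulVec_transpose, hRT]
      simp [dotProduct, div_eq_mul_inv]
    rw [← hR, h5, h4, Matrix.det_unique, Matrix.add_apply, Matrix.one_apply_eq,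
      Matrix.replicateRow_mul_replicateCol_apply, h6] at h3
    rw [← h3]
    ring
  · have h1 : (R * vecMulVec 1 1).trace = ∑ k, (R *ᵥ 1) k := by
      rw [Matrix.mul_vecMulVec, Matrix.trace_vecMulVec]
      simp [dotProduct]
    rw [← h1, ← hS, Matrix.mul_add, Matrix.trace_add, Matrix.trace_mul_comm, Matrix.mul_assoc, hQR,
      Matrix.mul_one, ← Matrix.mul_assoc, hRQ, Matrix.one_mul, Matrix.trace_diagonal]
    ring

theorem differentiableAt_det {A : ℝ → Matrix ι ι ℂ} {x : ℝ}
    (hA : ∀ j k, DifferentiableAt ℝ (fun y => A y j k) x) :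
    DifferentiableAt ℝ (fun y => (A y).det) x := by
  simp only [Matrix.det_apply]
  fun_prop

theorem differentiableAt_inv_mulVec {A : ℝ → Matrix ι ι ℂ} {z : ℝ → ι → ℂ} {x : ℝ}
    (hA : ∀ j k, DifferentiableAt ℝ (fun y => A y j k) x)
    (hz : ∀ j, DifferentiableAt ℝ (fun y => z y j) x) (hdet : (A x).det ≠ 0) (j : ι) :
    DifferentiableAt ℝ (fun y => ((A y)⁻¹ *ᵥ z y) j) x := by
  have hadj : ∀ k, DifferentiableAt ℝ (fun y => (A y).adjugate j k) x := by
    intro k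
    simp only [Matrix.adjugate_apply]
    refine differentiableAt_det fun l m => ?_
    by_cases hl : l = k
    · subst hl; simp
    · simpa [Matrix.updateRow_ne hl] using hA l m
  have hd := differentiableAt_det hA
  simp only [Matrix.inv_def, Ring.inverse_eq_inv', Matrix.mulVec, dotProduct, Matrix.smul_apply,
    smul_eq_mul]
  fun_prop (disch := assumption)

theorem hasDerivAt_inv_mulVec {A : ℝ → Matrix ι ι ℂ} {A' : Matrix ι ι ℂ} {z : ℝ → ι → ℂ}
    {z' w' : ι → ℂ} {x : ℝ} (hA : ∀ j k, HasDerivAt (fun y => A y j k) (A' j k) x)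
    (hz : ∀ j, HasDerivAt (fun y => z y j) (z' j) x) (hdet : (A x).det ≠ 0)
    (hw' : A x *ᵥ w' + A' *ᵥ ((A x)⁻¹ *ᵥ z x) = z') (j : ι) :
    HasDerivAt (fun y => ((A y)⁻¹ *ᵥ z y) j) (w' j) x := by
  have hw := fun k => (differentiableAt_inv_mulVec (fun j k => (hA j k).differentiableAt)
    (fun j => (hz j).differentiableAt) hdet k).hasDerivAt
  set d : ι → ℂ := fun k => deriv (fun y => ((A y)⁻¹ *ᵥ z y) k) x with hd
  have hev : ∀ᶠ y in nhds x, (A y).det ≠ 0 :=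
    (differentiableAt_det fun j k => (hA j k).differentiableAt).continuousAt.eventually_ne hdet
  have hAd : A x *ᵥ d + A' *ᵥ ((A x)⁻¹ *ᵥ z x) = z' := by
    funext l
    have h1 : HasDerivAt (fun y => ∑ k, A y l k * ((A y)⁻¹ *ᵥ z y) k)
        (∑ k, (A' l k * ((A x)⁻¹ *ᵥ z x) k + A x l k * d k)) x :=
      HasDerivAt.fun_sum fun k _ => (hA l k).mul (hw k)
    have h2 : (fun y => ∑ k, A y l k * ((A y)⁻¹ *ᵥ z y) k) =ᶠ[nhds x] fun y => z y l := by
      filter_upwards [hev] with y hy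
      have : A y *ᵥ ((A y)⁻¹ *ᵥ z y) = z y := by
        rw [Matrix.mulVec_mulVec, Matrix.mul_nonsing_inv _ (isUnit_iff_ne_zero.mpr hy),
          Matrix.one_mulVec]
      exact congrFun this l
    have h3 := (h1.congr_of_eventuallyEq h2.symm).unique (hz l)
    rw [← h3, Finset.sum_add_distrib, add_comm]
    rfl
  have hdw : d = w' :=
    Matrix.mulVec_injective_of_isUnit ((Matrix.isUnit_iff_isUnit_det _).mpr
      (isUnit_iff_ne_zero.mpr hdet)) (add_right_cancel (hAd.trans hw'.symm))
  rw [← hdw]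
  exact hw j

section Cauchy

variable {κ : ι → ℂ}

omit [DecidableEq ι] in
theorem cauchyGram_mulVec_mul (hκ : ∀ j k, κ j + κ k ≠ 0) (x : ι → ℂ) (j : ι) :
    (cauchyGram κ *ᵥ (κ * x)) j = ∑ k, x k - κ j * (cauchyGram κ *ᵥ x) j := by
  simp only [cauchyGram, Matrix.mulVec, dotProduct, Matrix.of_apply, Pi.mul_apply,
    Finset.mul_sum, ← Finset.sum_sub_distrib]
  refine Finset.sum_congr rfl fun k _ => ?_
  have := hκ j k
  field_simp
  ring

omit [DecidableEq ι] in
theorem sum_weighted_cauchyGram_form (f z x : ι → ℂ) :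
    ∑ j, f j * z j * (cauchyGram κ *ᵥ x) j + ∑ j, f j * x j * (cauchyGram κ *ᵥ z) j
      = ∑ j, ∑ k, (f j + f k) * (κ j + κ k)⁻¹ * (z j * x k) := by
  simp only [cauchyGram, Matrix.mulVec, dotProduct, Matrix.of_apply, Finset.mul_sum]
  rw [Finset.sum_comm (f := fun j k => f j * x j * ((κ j + κ k)⁻¹ * z k)),
    ← Finset.sum_add_distrib]
  refine Finset.sum_congr rfl fun j _ => ?_
  rw [← Finset.sum_add_distrib]
  refine Finset.sum_congr rfl fun k _ => ?_
  rw [add_comm (κ k) (κ j)]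
  ring

omit [DecidableEq ι] in
theorem sum_mul_cauchyGram_form (hκ : ∀ j k, κ j + κ k ≠ 0) (z x : ι → ℂ) :
    ∑ j, κ j * z j * (cauchyGram κ *ᵥ x) j + ∑ j, κ j * x j * (cauchyGram κ *ᵥ z) j
      = (∑ j, z j) * ∑ j, x j := by
  rw [sum_weighted_cauchyGram_form, Finset.sum_mul_sum]
  refine Finset.sum_congr rfl fun j _ => Finset.sum_congr rfl fun k _ => ?_
  rw [mul_inv_cancel₀ (hκ j k), one_mul]

omit [DecidableEq ι] in
theorem sum_inv_mul_cauchyGram_form (hκ : ∀ j k, κ j + κ k ≠ 0) (hκ0 : ∀ j, κ j ≠ 0)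
    (z x : ι → ℂ) :
    ∑ j, (κ j)⁻¹ * z j * (cauchyGram κ *ᵥ x) j + ∑ j, (κ j)⁻¹ * x j * (cauchyGram κ *ᵥ z) j
      = (∑ j, (κ j)⁻¹ * z j) * ∑ j, (κ j)⁻¹ * x j := by
  rw [sum_weighted_cauchyGram_form (fun j => (κ j)⁻¹), Finset.sum_mul_sum]
  refine Finset.sum_congr rfl fun j _ => Finset.sum_congr rfl fun k _ => ?_
  have := hκ j k
  have := hκ0 j
  have := hκ0 k
  field_simp
  ring

omit [DecidableEq ι] in
theorem sum_mul_cauchyGram_comm (z x : ι → ℂ) :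
    ∑ j, z j * (cauchyGram κ *ᵥ x) j = ∑ j, x j * (cauchyGram κ *ᵥ z) j := by
  simp only [cauchyGram, Matrix.mulVec, dotProduct, Matrix.of_apply, Finset.mul_sum]
  rw [Finset.sum_comm]
  refine Finset.sum_congr rfl fun j _ => Finset.sum_congr rfl fun k _ => ?_
  rw [add_comm (κ k) (κ j)]
  ring

omit [DecidableEq ι] in
theorem cauchyGram_mulVec_star (hκs : ∀ j, star (κ j) = κ j) (x : ι → ℂ) :
    cauchyGram κ *ᵥ star x = star (cauchyGram κ *ᵥ x) := by
  funext j
  simp only [cauchyGram, Matrix.mulVec, dotProduct, Matrix.of_apply, Pi.star_apply, star_sum,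
    star_mul', star_inv₀, star_add, hκs]

/-- `y` is real with nonzero entries, solves `Q y = 1` for the Cauchy matrix `Q` of `κ`, and
`diag(y) Q` is an involution. -/
structure IsCauchyReflection (κ y : ι → ℂ) : Prop where
  add_ne_zero : ∀ j k, κ j + κ k ≠ 0
  ne_zero : ∀ j, κ j ≠ 0
  star_eq : ∀ j, star (κ j) = κ j
  y_ne_zero : ∀ j, y j ≠ 0
  star_y_eq : ∀ j, star (y j) = y j
  mulVec_y : cauchyGram κ *ᵥ y = 1
  involutive : ∀ x, y * cauchyGram κ *ᵥ (y * cauchyGram κ *ᵥ x) = x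
  sum_inv_mul_y : ∑ k, (κ k)⁻¹ * y k = 1 - (-1) ^ Fintype.card ι

namespace IsCauchyReflection

variable {y : ι → ℂ} (h : IsCauchyReflection κ y)
include h

omit [DecidableEq ι]

theorem sum_reflect (x : ι → ℂ) : ∑ j, y j * (cauchyGram κ *ᵥ x) j = ∑ j, x j := by
  simp [sum_mul_cauchyGram_comm y x, h.mulVec_y]

theorem sum_mul_reflect (x : ι → ℂ) :
    ∑ j, κ j * (y j * (cauchyGram κ *ᵥ x) j) + ∑ j, κ j * x j = (∑ j, y j) * ∑ j, x j := by
  rw [← sum_mul_cauchyGram_form h.add_ne_zero]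
  simp [h.mulVec_y, mul_assoc]

theorem sum_inv_mul_reflect (x : ι → ℂ) :
    ∑ j, (κ j)⁻¹ * (y j * (cauchyGram κ *ᵥ x) j)
      = -(-1) ^ Fintype.card ι * ∑ j, (κ j)⁻¹ * x j := by
  have h1 := sum_inv_mul_cauchyGram_form h.add_ne_zero h.ne_zero y x
  simp only [h.mulVec_y, h.sum_inv_mul_y, Pi.one_apply, mul_one, mul_assoc] at h1
  linear_combination h1

theorem mulVec_of_reflect {x : ι → ℂ} {ε σ : ℂ}
    (hx : ∀ j, y j * (cauchyGram κ *ᵥ x) j = ε * x j + σ * y j) (j : ι) :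
    (cauchyGram κ *ᵥ x) j = ε * (x j / y j) + σ := by
  have hy := h.y_ne_zero j
  field_simp
  linear_combination hx j

/-- For an eigenvector `x` of the reflection, `∑ κⱼ|xⱼ|²/yⱼ` is a multiple of `|∑ xⱼ|²`. -/
theorem sum_mul_normSq {x : ι → ℂ} {ε : ℂ} (hε : star ε = ε)
    (hx : ∀ j, y j * (cauchyGram κ *ᵥ x) j = ε * x j) :
    2 * ε * ∑ j, κ j * (star (x j) * x j / y j) = star (∑ j, x j) * ∑ j, x j := by
  have hQ : ∀ j, (cauchyGram κ *ᵥ x) j = ε * (x j / y j) := fun j => by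
    simpa using h.mulVec_of_reflect (σ := 0) (by simpa using hx) j
  have hQs : ∀ j, (cauchyGram κ *ᵥ star x) j = ε * (star (x j) / y j) := fun j => by
    rw [cauchyGram_mulVec_star h.star_eq, Pi.star_apply, hQ]
    simp only [star_mul', star_div₀, hε, h.star_y_eq]
  have h1 := sum_mul_cauchyGram_form h.add_ne_zero (star x) x
  simp only [hQ, hQs, Pi.star_apply, ← star_sum] at h1
  rw [← h1, ← Finset.sum_add_distrib, Finset.mul_sum]
  refine Finset.sum_congr rfl fun j _ => ?_
  ring

/-- The analogue of `sum_mul_normSq` with weights `κⱼ⁻¹`, for an affine eigenvector. -/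
theorem sum_inv_mul_normSq {x : ι → ℂ} {ε σ : ℂ} (hε : star ε = ε)
    (hx : ∀ j, y j * (cauchyGram κ *ᵥ x) j = ε * x j + σ * y j) :
    2 * ε * ∑ j, (κ j)⁻¹ * (star (x j) * x j / y j) + σ * star (∑ j, (κ j)⁻¹ * x j)
      + star σ * ∑ j, (κ j)⁻¹ * x j
      = star (∑ j, (κ j)⁻¹ * x j) * ∑ j, (κ j)⁻¹ * x j := by
  have hQ := h.mulVec_of_reflect hx
  have hQs : ∀ j, (cauchyGram κ *ᵥ star x) j = ε * (star (x j) / y j) + star σ := fun j => by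
    rw [cauchyGram_mulVec_star h.star_eq, Pi.star_apply, hQ]
    simp only [star_add, star_mul', star_div₀, hε, h.star_y_eq]
  have hs : star (∑ j, (κ j)⁻¹ * x j) = ∑ j, (κ j)⁻¹ * star x j := by
    simp only [star_sum, star_mul', star_inv₀, h.star_eq, Pi.star_apply]
  have h1 := sum_inv_mul_cauchyGram_form h.add_ne_zero h.ne_zero (star x) x
  rw [← hs] at h1
  rw [← h1, hs]
  simp only [hQ, hQs, Finset.mul_sum, ← Finset.sum_add_distrib, Pi.star_apply]
  refine Finset.sum_congr rfl fun j _ => ?_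
  ring

variable {α : ℂ} {D w : ι → ℂ}

/-- The first-moment identity behind the Robin condition, for an even number of solitons. -/
theorem robin_of_even (hN : Even (Fintype.card ι)) (hα : star α = α)
    (hD : ∀ j, (κ j - α) * (D j * star (D j)) = κ j + α)
    (hw : ∀ j, D j * (cauchyGram κ *ᵥ (star D * w)) j + (cauchyGram κ *ᵥ w) j = D j)
    (hP : ∀ z, (∀ j, D j * (cauchyGram κ *ᵥ (star D * z)) j + (cauchyGram κ *ᵥ z) j = 0) →
      z = 0) :
    ∑ j, (κ j + α) * w j = (∑ j, w j) * (∑ j, y j - ∑ j, star (D j) * w j) := by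
  set Q := cauchyGram κ with hQ
  set a := star D * w with ha
  set η : ι → ℂ := y - y * Q *ᵥ a - a with hη
  set θ : ι → ℂ := κ * (y * Q *ᵥ w) - α • (y * Q *ᵥ w) - κ * w - α • w with hθ
  have hDη : ∀ j, D j * η j = y j * (Q *ᵥ w) j - D j * (star (D j) * w j) := fun j => by
    simp only [hη, ha, Pi.sub_apply, Pi.mul_apply, Pi.star_apply]
    linear_combination -y j * hw j
  have hθη : ∀ j, θ j = (κ j - α) * (D j * η j) := fun j => by
    rw [hDη]
    simp only [hθ, Pi.sub_apply, Pi.mul_apply, Pi.smul_apply, smul_eq_mul]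
    linear_combination w j * hD j
  have hJη : ∀ j, y j * (Q *ᵥ η) j = η j := fun j => by
    have h1 := congrFun (h.involutive a) j
    simp only [← hQ, Pi.mul_apply] at h1
    have h2 := congrFun h.mulVec_y j
    rw [← hQ, Pi.one_apply] at h2
    simp only [hη, Matrix.mulVec_sub, Pi.sub_apply, Pi.mul_apply]
    linear_combination y j * h2 - h1
  have hJθ : ∀ j, y j * (Q *ᵥ θ) j = θ j := fun j => by
    have h1 := congrFun (h.involutive w) j
    have h2 := h.sum_reflect w
    simp only [← hQ, Pi.mul_apply] at h1 h2
    simp only [hθ, Matrix.mulVec_sub, Matrix.mulVec_smul, Pi.sub_apply, Pi.mul_apply,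
      cauchyGram_mulVec_mul h.add_ne_zero, hQ, Pi.smul_apply, smul_eq_mul]
    simp only [← hQ]
    linear_combination y j * h2 - (κ j + α) * h1
  have hzero : ∀ x : ι → ℂ, (∀ j, y j * (Q *ᵥ x) j = x j) →
      ∑ j, (κ j)⁻¹ * (star (x j) * x j / y j) = 0 := fun x hx => by
    have h1 := h.sum_inv_mul_reflect x
    simp only [← hQ, hx, hN.neg_one_pow] at h1
    have h2 : ∑ j, (κ j)⁻¹ * x j = 0 := by linear_combination h1 / 2
    have h3 := h.sum_inv_mul_normSq (ε := 1) (σ := 0) (star_one _) (x := x) (by simpa using hx)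
    simpa [h2] using h3
  have hη0 : ∑ j, η j = 0 := by
    have h1 := h.sum_mul_normSq (ε := 1) (star_one _) (x := η) (by simpa using hJη)
    have h2 : ∑ j, κ j * (star (η j) * η j / y j)
        = ∑ j, (κ j)⁻¹ * (star (θ j) * θ j / y j)
          + α ^ 2 * ∑ j, (κ j)⁻¹ * (star (η j) * η j / y j) := by
      rw [Finset.mul_sum, ← Finset.sum_add_distrib]
      refine Finset.sum_congr rfl fun j _ => ?_
      have h3 := h.ne_zero j
      have h4 := h.y_ne_zero j
      rw [hθη]
      simp only [star_mul', star_sub, h.star_eq, hα]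
      field_simp
      linear_combination -(κ j - α) * star (η j) * η j * hD j
    rw [h2, hzero θ hJθ, hzero η hJη] at h1
    have h3 : star (∑ j, η j) * ∑ j, η j = 0 := by rw [← h1]; ring
    exact (mul_eq_zero.mp h3).elim star_eq_zero.mp id
  have hθ0 : θ = 0 := by
    refine hP θ fun j => ?_
    have h1 : star D * θ = κ * η + α • η := by
      funext k
      simp only [Pi.mul_apply, Pi.add_apply, Pi.smul_apply, smul_eq_mul, Pi.star_apply, hθη]
      linear_combination η k * hD k
    refine (mul_eq_zero.mp ?_).resolve_left (h.y_ne_zero j)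
    rw [h1, Matrix.mulVec_add, Matrix.mulVec_smul, Pi.add_apply, hQ,
      cauchyGram_mulVec_mul h.add_ne_zero, ← hQ, hη0, Pi.smul_apply, smul_eq_mul]
    linear_combination hJθ j - (κ j - α) * D j * hJη j + hθη j
  have hs : ∑ j, y j = 2 * ∑ j, a j := by
    have h1 := h.sum_reflect a
    simp only [hη, Pi.sub_apply, Pi.mul_apply, Finset.sum_sub_distrib] at hη0
    linear_combination hη0 + h1
  have h1 := h.sum_mul_reflect w
  have h2 := h.sum_reflect w
  have h3 : ∑ j, θ j = 0 := by simp [hθ0]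
  simp only [hθ, Pi.sub_apply, Pi.mul_apply, Pi.smul_apply, smul_eq_mul, Finset.sum_sub_distrib,
    ← Finset.mul_sum] at h3
  have h4 : ∑ j, star (D j) * w j = ∑ j, a j := rfl
  simp only [add_mul, Finset.sum_add_distrib, ← Finset.mul_sum]
  rw [h4]
  linear_combination (1 / 2) * h1 - (α / 2) * h2 - (1 / 2) * h3 - (∑ j, w j) / 2 * hs

/-- The first-moment identity behind the Robin condition, for an odd number of solitons. -/
theorem robin_of_odd (hN : Odd (Fintype.card ι)) (hα : star α = α)
    (hκα : ∀ j, κ j - α ≠ 0) (hκα' : ∀ j, κ j + α ≠ 0)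
    (hD : ∀ j, (κ j + α) * (D j * star (D j)) = κ j - α)
    (hw : ∀ j, D j * (cauchyGram κ *ᵥ (star D * w)) j + (cauchyGram κ *ᵥ w) j = D j)
    (hP : ∀ z, (∀ j, D j * (cauchyGram κ *ᵥ (star D * z)) j + (cauchyGram κ *ᵥ z) j = 0) →
      z = 0) :
    ∑ j, (κ j + α) * w j = (∑ j, w j) * (∑ j, y j - ∑ j, star (D j) * w j) := by
  set Q := cauchyGram κ with hQ
  set a := star D * w with ha
  set d : ι → ℂ := y * Q *ᵥ w - w with hd
  set ξ : ι → ℂ := κ * y - α • y - κ * (y * Q *ᵥ a) + α • (y * Q *ᵥ a) - κ * a - α • a with hξ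
  set σ : ℂ := ∑ j, y j - 2 * ∑ j, a j - 2 * α with hσ
  have hD0 : ∀ j, D j ≠ 0 := fun j hj => hκα j (by rw [← hD j, hj]; ring)
  have hDξ : ∀ j, D j * ξ j = (κ j - α) * d j := fun j => by
    simp only [hξ, hd, ha, Pi.sub_apply, Pi.add_apply, Pi.mul_apply, Pi.star_apply, Pi.smul_apply,
      smul_eq_mul]
    linear_combination -(κ j - α) * y j * hw j - w j * hD j
  have hEd : ∀ j, star (D j) * ((κ j + α) * d j) = ξ j := fun j => by
    refine mul_left_cancel₀ (hD0 j) ?_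
    linear_combination d j * hD j - hDξ j
  have hJd : ∀ j, y j * (Q *ᵥ d) j = -1 * d j := fun j => by
    have h1 := congrFun (h.involutive w) j
    simp only [← hQ, Pi.mul_apply] at h1
    simp only [hd, Matrix.mulVec_sub, Pi.sub_apply, Pi.mul_apply]
    linear_combination h1
  have hJξ : ∀ j, y j * (Q *ᵥ ξ) j = -1 * ξ j + σ * y j := fun j => by
    have h1 := congrFun (h.involutive a) j
    have h2 := h.sum_reflect a
    simp only [← hQ, Pi.mul_apply] at h1 h2
    simp only [hξ, Matrix.mulVec_sub, Matrix.mulVec_add, Matrix.mulVec_smul, Pi.sub_apply,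
      Pi.add_apply, Pi.mul_apply, cauchyGram_mulVec_mul h.add_ne_zero, hQ, Pi.smul_apply,
      smul_eq_mul, h.mulVec_y, Pi.one_apply]
    simp only [← hQ, hσ]
    linear_combination -y j * h2 + (κ j + α) * h1
  have hdsum : ∑ j, d j = 0 := by
    have h1 := h.sum_reflect d
    simp only [← hQ, hJd, ← Finset.mul_sum] at h1
    linear_combination -h1 / 2
  have hdinv : ∑ j, (κ j)⁻¹ * d j = 0 := by
    have h1 := h.sum_inv_mul_reflect d
    simp only [← hQ, hJd, hN.neg_one_pow, mul_left_comm _ (-1 : ℂ), ← Finset.mul_sum] at h1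
    linear_combination -h1 / 2
  have hξinv : ∑ j, (κ j)⁻¹ * ξ j = σ := by
    have h1 := h.sum_inv_mul_reflect ξ
    have h2 := h.sum_inv_mul_y
    simp only [← hQ, hJξ, hN.neg_one_pow, mul_add, Finset.sum_add_distrib,
      mul_left_comm _ (-1 : ℂ), mul_left_comm _ σ, ← Finset.mul_sum] at h1 h2
    linear_combination -h1 / 2 + σ / 2 * h2
  have hd1 : ∑ j, κ j * (star (d j) * d j / y j) = 0 := by
    have h1 := h.sum_mul_normSq (ε := -1) (by simp) hJd
    rw [hdsum] at h1
    linear_combination -h1 / 2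
  have hd2 : ∑ j, (κ j)⁻¹ * (star (d j) * d j / y j) = 0 := by
    have h1 := h.sum_inv_mul_normSq (ε := -1) (σ := 0) (by simp) (x := d) (by simpa using hJd)
    rw [hdinv] at h1
    linear_combination -h1 / 2
  have hσ0 : σ = 0 := by
    have h1 := h.sum_inv_mul_normSq (ε := -1) (by simp) hJξ
    have h2 : ∑ j, (κ j)⁻¹ * (star (ξ j) * ξ j / y j)
        = ∑ j, κ j * (star (d j) * d j / y j)
          - α ^ 2 * ∑ j, (κ j)⁻¹ * (star (d j) * d j / y j) := by
      rw [Finset.mul_sum, ← Finset.sum_sub_distrib]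
      refine Finset.sum_congr rfl fun j _ => ?_
      have h3 := h.ne_zero j
      have h4 := h.y_ne_zero j
      rw [← hEd]
      simp only [star_mul', star_add, h.star_eq, hα, star_star]
      field_simp
      linear_combination (κ j + α) * star (d j) * d j * hD j
    rw [h2, hd1, hd2, hξinv] at h1
    have h3 : star σ * σ = 0 := by linear_combination h1
    simpa using h3
  have hd0 : ∀ j, d j = 0 := by
    have h1 := hP (κ * d + α • d) fun j => by
      have h2 : star D * (κ * d + α • d) = ξ := by
        funext k
        rw [← hEd k]
        simp only [Pi.mul_apply, Pi.add_apply, Pi.smul_apply, smul_eq_mul, Pi.star_apply, add_mul]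
      refine (mul_eq_zero.mp ?_).resolve_left (h.y_ne_zero j)
      have h3 := hJξ j
      rw [hσ0] at h3
      rw [h2, Matrix.mulVec_add, Matrix.mulVec_smul, Pi.add_apply, hQ,
        cauchyGram_mulVec_mul h.add_ne_zero, ← hQ, hdsum, Pi.smul_apply, smul_eq_mul]
      linear_combination D j * h3 - (κ j - α) * hJd j - hDξ j
    intro j
    have h2 := congrFun h1 j
    simp only [Pi.mul_apply, Pi.add_apply, Pi.smul_apply, smul_eq_mul, Pi.zero_apply,
      ← add_mul] at h2
    exact (mul_eq_zero.mp h2).resolve_left (hκα' j)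
  have h1 := h.sum_mul_reflect w
  have h2 : ∀ j, y j * (Q *ᵥ w) j = w j := fun j => sub_eq_zero.mp (hd0 j)
  simp only [← hQ, h2] at h1
  have h4 : ∑ j, star (D j) * w j = ∑ j, a j := rfl
  simp only [add_mul, Finset.sum_add_distrib, ← Finset.mul_sum]
  rw [h4]
  linear_combination (1 / 2) * h1 - (∑ j, w j) / 2 * (hσ0 + hσ)

end IsCauchyReflection

end Cauchy

theorem exists_isCauchyReflection {κ : ι → ℝ} (hκ : ∀ j, 0 < κ j)
    (hinj : Function.Injective κ) :
    ∃ y : ι → ℂ, IsCauchyReflection (fun j => (κ j : ℂ)) y ∧ ∑ j, y j = 2 * ∑ j, (κ j : ℂ) := by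
  have hκ2 : ∀ j k, κ j + κ k ≠ 0 := fun j k => (add_pos (hκ j) (hκ k)).ne'
  obtain ⟨y, hy0, hy1, hyy, hyinv, hys⟩ :=
    exists_cauchyGram_involution hκ2 (fun j => (hκ j).ne') hinj
  refine ⟨fun j => y j, ⟨fun j k => by exact_mod_cast hκ2 j k, fun j => by
    exact_mod_cast (hκ j).ne', fun j => Complex.conj_ofReal _, fun j => by exact_mod_cast hy0 j,
    fun j => Complex.conj_ofReal _, ?_, ?_, ?_⟩, ?_⟩
  · funext j
    simp only [cauchyGram, Matrix.mulVec, dotProduct, Matrix.of_apply, Pi.one_apply,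
      inv_mul_eq_div]
    exact_mod_cast hy1 j
  · intro x
    funext j
    simp only [cauchyGram, Matrix.mulVec, dotProduct, Matrix.of_apply, Pi.mul_apply,
      Finset.mul_sum]
    rw [Finset.sum_comm]
    have h1 : ∀ l, ∑ k, (y j : ℂ) * (((κ j : ℂ) + κ k)⁻¹ * (y k * (((κ k : ℂ) + κ l)⁻¹ * x l)))
        = (if j = l then 1 else 0) * x l := by
      intro l
      have h2 : (∑ k, (y j : ℂ) / (κ j + κ k) * (y k / (κ k + κ l))) = if j = l then 1 else 0 := by
        have h3 := congrArg (fun r : ℝ => (r : ℂ)) (hyy j l)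
        push_cast at h3
        rw [h3]
        split_ifs <;> simp
      rw [← h2, Finset.sum_mul]
      refine Finset.sum_congr rfl fun k _ => ?_
      ring
    simp [h1]
  · simp only [inv_mul_eq_div]
    exact_mod_cast hyinv
  · have h1 := congrArg (fun r : ℝ => (r : ℂ)) hys
    push_cast at h1
    exact h1

/-- The Hermitian matrix with entries `(eⱼ eₖ* + 1) / (κⱼ + κₖ)`. -/
def solitonGram (κ e : ι → ℂ) : Matrix ι ι ℂ :=
  Matrix.of fun j k => (e j * star (e k) + 1) * (κ j + κ k)⁻¹

section SolitonGram

variable {κ e : ι → ℂ}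

omit [DecidableEq ι] in
theorem solitonGram_mulVec (x : ι → ℂ) (j : ι) :
    (solitonGram κ e *ᵥ x) j
      = e j * (cauchyGram κ *ᵥ (star e * x)) j + (cauchyGram κ *ᵥ x) j := by
  simp only [solitonGram, cauchyGram, Matrix.mulVec, dotProduct, Matrix.of_apply, Pi.mul_apply,
    Pi.star_apply, Finset.mul_sum, ← Finset.sum_add_distrib]
  refine Finset.sum_congr rfl fun k _ => ?_
  ring

omit [DecidableEq ι] in
theorem solitonGram_mulVec_mul (hκ : ∀ j k, κ j + κ k ≠ 0) (x : ι → ℂ) (j : ι) :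
    (solitonGram κ e *ᵥ (κ * x)) j
      = e j * ∑ k, star (e k) * x k + ∑ k, x k - κ j * (solitonGram κ e *ᵥ x) j := by
  have h : star e * (κ * x) = κ * (star e * x) := by ring
  rw [solitonGram_mulVec, solitonGram_mulVec, h, cauchyGram_mulVec_mul hκ,
    cauchyGram_mulVec_mul hκ]
  simp only [Pi.mul_apply, Pi.star_apply]
  ring

theorem mulVec_inv_mulVec {A : Matrix ι ι ℂ} (hdet : A.det ≠ 0) (z : ι → ℂ) :
    A *ᵥ (A⁻¹ *ᵥ z) = z := by
  rw [Matrix.mulVec_mulVec, Matrix.mul_nonsing_inv _ (isUnit_iff_ne_zero.mpr hdet),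
    Matrix.one_mulVec]

theorem sum_star_mul_solitonGram_inv (hκs : ∀ j, star (κ j) = κ j) :
    ∑ j, star (e j) * ((solitonGram κ e)⁻¹ *ᵥ 1) j
      = star (∑ j, ((solitonGram κ e)⁻¹ *ᵥ e) j) := by
  have hH : (solitonGram κ e)ᴴ = solitonGram κ e := by
    ext j k
    simp only [solitonGram, Matrix.conjTranspose_apply, Matrix.of_apply, star_mul', star_add,
      star_one, star_star, star_inv₀, hκs]
    ring
  have h1 : star e ⬝ᵥ ((solitonGram κ e)⁻¹ *ᵥ 1)
      = star ((solitonGram κ e)⁻¹ *ᵥ e) ⬝ᵥ (1 : ι → ℂ) := by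
    rw [Matrix.star_mulVec, Matrix.conjTranspose_nonsing_inv, hH, Matrix.dotProduct_mulVec]
  simpa [dotProduct] using h1

theorem solitonGram_trace_identity (hκ : ∀ j k, κ j + κ k ≠ 0)
    (hdet : (solitonGram κ e).det ≠ 0) :
    ∑ j, star (e j) * ((solitonGram κ e)⁻¹ *ᵥ e) j + ∑ j, ((solitonGram κ e)⁻¹ *ᵥ 1) j
      = 2 * ∑ j, κ j := by
  set G := solitonGram κ e with hG
  have hS : diagonal κ * G + G * diagonal κ = vecMulVec e (star e) + vecMulVec 1 1 := by
    ext j k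
    have := hκ j k
    simp only [hG, solitonGram, Matrix.add_apply, Matrix.diagonal_mul, Matrix.mul_diagonal,
      Matrix.of_apply, vecMulVec_apply, Pi.one_apply, Pi.star_apply]
    field_simp
  have hu : IsUnit G.det := isUnit_iff_ne_zero.mpr hdet
  have h1 := congrArg (fun A => (G⁻¹ * A).trace) hS
  simp only [Matrix.mul_add, Matrix.trace_add, Matrix.mul_vecMulVec, Matrix.trace_vecMulVec] at h1
  rw [Matrix.trace_mul_comm, Matrix.mul_assoc, Matrix.mul_nonsing_inv _ hu, Matrix.mul_one,
    ← Matrix.mul_assoc, Matrix.nonsing_inv_mul _ hu, Matrix.one_mul, Matrix.trace_diagonal] at h1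
  simp only [dotProduct, Pi.star_apply, Pi.one_apply, mul_one] at h1
  rw [two_mul, h1]
  simp only [mul_comm]

end SolitonGram

section Flow

variable {κ : ι → ℂ} {e : ℝ → ι → ℂ} {s : ℝ}

omit [Fintype ι] [DecidableEq ι] in
theorem hasDerivAt_solitonGram_of_x_flow (hκ : ∀ j k, κ j + κ k ≠ 0)
    (hκs : ∀ j, star (κ j) = κ j)
    (he : ∀ j, HasDerivAt (fun y => e y j) (2 * κ j * e s j) s) (j k : ι) :
    HasDerivAt (fun y => solitonGram κ (e y) j k) (2 * e s j * star (e s k)) s := by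
  have h := (((he j).mul (he k).star).add_const 1).mul_const (κ j + κ k)⁻¹
  refine h.congr_deriv ?_
  have := hκ j k
  simp only [star_mul', hκs, star_ofNat]
  field_simp

theorem hasDerivAt_solitonGram_inv_mulVec_of_x_flow (hκ : ∀ j k, κ j + κ k ≠ 0)
    (hκs : ∀ j, star (κ j) = κ j)
    (he : ∀ j, HasDerivAt (fun y => e y j) (2 * κ j * e s j) s)
    (hdet : (solitonGram κ (e s)).det ≠ 0) (j : ι) :
    HasDerivAt (fun y => ((solitonGram κ (e y))⁻¹ *ᵥ e y) j)
      (-2 * (κ j * ((solitonGram κ (e s))⁻¹ *ᵥ e s) j)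
        + 2 * (∑ k, ((solitonGram κ (e s))⁻¹ *ᵥ e s) k)
          * ((solitonGram κ (e s))⁻¹ *ᵥ 1) j) s := by
  set w := (solitonGram κ (e s))⁻¹ *ᵥ e s with hw
  set v := (solitonGram κ (e s))⁻¹ *ᵥ 1 with hv
  have hGw : solitonGram κ (e s) *ᵥ w = e s := mulVec_inv_mulVec hdet _
  have hGv : solitonGram κ (e s) *ᵥ v = 1 := mulVec_inv_mulVec hdet _
  refine hasDerivAt_inv_mulVec (A := fun y => solitonGram κ (e y))
    (A' := Matrix.of fun j k => 2 * e s j * star (e s k))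
    (w' := (-2 : ℂ) • (κ * w) + (2 * ∑ k, w k) • v)
    (fun j k => hasDerivAt_solitonGram_of_x_flow hκ hκs he j k) he hdet ?_ j
  rw [← hw]
  funext l
  have h1 : ((Matrix.of fun j k => 2 * e s j * star (e s k)) *ᵥ w) l
      = 2 * e s l * ∑ k, star (e s k) * w k := by
    simp only [Matrix.mulVec, dotProduct, Matrix.of_apply, Finset.mul_sum, mul_assoc]
  rw [Pi.add_apply, h1, Matrix.mulVec_add, Matrix.mulVec_smul, Matrix.mulVec_smul, hGv]
  simp only [Pi.add_apply, Pi.smul_apply, smul_eq_mul, Pi.one_apply, solitonGram_mulVec_mul hκ,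
    hGw]
  ring

theorem hasDerivAt_solitonGram_inv_mulVec_one_of_x_flow (hκ : ∀ j k, κ j + κ k ≠ 0)
    (hκs : ∀ j, star (κ j) = κ j)
    (he : ∀ j, HasDerivAt (fun y => e y j) (2 * κ j * e s j) s)
    (hdet : (solitonGram κ (e s)).det ≠ 0) (j : ι) :
    HasDerivAt (fun y => ((solitonGram κ (e y))⁻¹ *ᵥ 1) j)
      (-2 * star (∑ k, ((solitonGram κ (e s))⁻¹ *ᵥ e s) k)
        * ((solitonGram κ (e s))⁻¹ *ᵥ e s) j) s := by
  have hev := sum_star_mul_solitonGram_inv (e := e s) hκs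
  set w := (solitonGram κ (e s))⁻¹ *ᵥ e s with hw
  set v := (solitonGram κ (e s))⁻¹ *ᵥ 1 with hv
  have hGw : solitonGram κ (e s) *ᵥ w = e s := mulVec_inv_mulVec hdet _
  refine hasDerivAt_inv_mulVec (A := fun y => solitonGram κ (e y)) (z := fun _ => 1) (z' := 0)
    (A' := Matrix.of fun j k => 2 * e s j * star (e s k))
    (w' := (-2 * star (∑ k, w k)) • w)
    (fun j k => hasDerivAt_solitonGram_of_x_flow hκ hκs he j k)
    (fun j => hasDerivAt_const s _) hdet ?_ j
  rw [← hv]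
  funext l
  have h1 : ((Matrix.of fun j k => 2 * e s j * star (e s k)) *ᵥ v) l
      = 2 * e s l * ∑ k, star (e s k) * v k := by
    simp only [Matrix.mulVec, dotProduct, Matrix.of_apply, Finset.mul_sum, mul_assoc]
  rw [Pi.add_apply, h1, Matrix.mulVec_smul, hGw, hev]
  simp only [Pi.smul_apply, smul_eq_mul, Pi.zero_apply]
  ring

theorem hasDerivAt_solitonGram_inv_mulVec_of_t_flow (hκ : ∀ j k, κ j + κ k ≠ 0)
    (hκs : ∀ j, star (κ j) = κ j)
    (he : ∀ j, HasDerivAt (fun y => e y j) (4 * I * κ j ^ 2 * e s j) s)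
    (hdet : (solitonGram κ (e s)).det ≠ 0) {w v : ι → ℂ}
    (hw : w = (solitonGram κ (e s))⁻¹ *ᵥ e s) (hv : v = (solitonGram κ (e s))⁻¹ *ᵥ 1) (j : ι) :
    HasDerivAt (fun y => ((solitonGram κ (e y))⁻¹ *ᵥ e y) j)
      (4 * I * (star (∑ k, w k) * (∑ k, w k) * w j
        + ((∑ k, w k) * (∑ k, v k) - ∑ k, κ k * w k) * v j
        + κ j * (κ j * w j) - (∑ k, w k) * (κ j * v j))) s := by
  have hev := sum_star_mul_solitonGram_inv (e := e s) hκs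
  rw [← hw, ← hv] at hev
  have hGw : solitonGram κ (e s) *ᵥ w = e s := hw ▸ mulVec_inv_mulVec hdet _
  have hGv : solitonGram κ (e s) *ᵥ v = 1 := hv ▸ mulVec_inv_mulVec hdet _
  have hA : ∀ j k, HasDerivAt (fun y => solitonGram κ (e y) j k)
      (4 * I * (κ j - κ k) * e s j * star (e s k)) s := by
    intro j k
    have h := (((he j).mul (he k).star).add_const 1).mul_const (κ j + κ k)⁻¹
    refine h.congr_deriv ?_
    have := hκ j k
    simp only [star_mul', hκs, star_ofNat, star_pow, Complex.star_def, Complex.conj_I]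
    field_simp
    ring
  refine hasDerivAt_inv_mulVec (A := fun y => solitonGram κ (e y))
    (A' := Matrix.of fun j k => 4 * I * (κ j - κ k) * e s j * star (e s k))
    (w' := (4 * I) • ((star (∑ k, w k) * ∑ k, w k) • w
      + ((∑ k, w k) * (∑ k, v k) - ∑ k, κ k * w k) • v
      + κ * (κ * w) - (∑ k, w k) • (κ * v))) hA he hdet ?_ j
  rw [← hw]
  funext l
  have h1 : ((Matrix.of fun j k => 4 * I * (κ j - κ k) * e s j * star (e s k)) *ᵥ w) l
      = 4 * I * e s l * (κ l * (∑ k, star (e s k) * w k)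
        - ∑ k, star (e s k) * (κ k * w k)) := by
    simp only [Matrix.mulVec, dotProduct, Matrix.of_apply, Finset.mul_sum,
      ← Finset.sum_sub_distrib]
    refine Finset.sum_congr rfl fun k _ => ?_
    ring
  rw [Pi.add_apply, h1]
  simp only [Matrix.mulVec_smul, Matrix.mulVec_add, Matrix.mulVec_sub, hGw, hGv, Pi.add_apply,
    Pi.sub_apply, Pi.smul_apply, smul_eq_mul, Pi.one_apply, solitonGram_mulVec_mul hκ, hev,
    Pi.mul_apply]
  ring

end Flow

/-- The scalar part `e^{−2i(λⱼx + 2λⱼ²t)} cⱼ` of a soliton vector with `λⱼ = iκⱼ`. -/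
def stationaryPhase (κ c : ι → ℂ) (p : ℝ × ℝ) (j : ι) : ℂ :=
  Complex.exp (-2 * Complex.I * ((I * κ j) * p.1 + 2 * (I * κ j) ^ 2 * p.2)) * c j

section Stationary

variable {κ c : ι → ℂ}

omit [Fintype ι] [DecidableEq ι] in
theorem hasDerivAt_stationaryPhase_x (x t : ℝ) (j : ι) :
    HasDerivAt (fun y : ℝ => stationaryPhase κ c (y, t) j)
      (2 * κ j * stationaryPhase κ c (x, t) j) x := by
  have h1 : HasDerivAt (fun y : ℝ => -2 * Complex.I * ((I * κ j) * (y : ℂ)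
      + 2 * (I * κ j) ^ 2 * (t : ℂ))) (-2 * Complex.I * ((I * κ j) * 1)) x :=
    ((Complex.ofRealCLM.hasDerivAt.const_mul (I * κ j)).add_const _).const_mul _
  refine (h1.cexp.mul_const (c j)).congr_deriv ?_
  simp only [stationaryPhase]
  ring_nf
  simp only [Complex.I_sq]
  ring

omit [Fintype ι] [DecidableEq ι] in
theorem hasDerivAt_stationaryPhase_t (x t : ℝ) (j : ι) :
    HasDerivAt (fun y : ℝ => stationaryPhase κ c (x, y) j)
      (4 * I * κ j ^ 2 * stationaryPhase κ c (x, t) j) t := by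
  have h1 : HasDerivAt (fun y : ℝ => -2 * Complex.I * ((I * κ j) * (x : ℂ)
      + 2 * (I * κ j) ^ 2 * (y : ℂ))) (-2 * Complex.I * (2 * (I * κ j) ^ 2 * 1)) t :=
    ((Complex.ofRealCLM.hasDerivAt.const_mul (2 * (I * κ j) ^ 2)).const_add _).const_mul _
  refine (h1.cexp.mul_const (c j)).congr_deriv ?_
  have h2 : -2 * Complex.I * (2 * (I * κ j) ^ 2 * 1) = 4 * I * κ j ^ 2 := by
    linear_combination (-4 * I * κ j ^ 2) * Complex.I_sq
  rw [h2]
  simp only [stationaryPhase]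
  ring

omit [Fintype ι] [DecidableEq ι] in
theorem stationaryPhase_mul_star (hκs : ∀ j, star (κ j) = κ j) (t : ℝ) (j : ι) :
    stationaryPhase κ c (0, t) j * star (stationaryPhase κ c (0, t) j) = c j * star (c j) := by
  have hκj : (starRingEnd ℂ) (κ j) = κ j := hκs j
  simp only [stationaryPhase, star_mul', Complex.star_def, ← Complex.exp_conj, map_mul, map_add,
    map_neg, map_pow, map_ofNat, Complex.conj_I, Complex.conj_ofReal, hκj]
  rw [mul_mul_mul_comm, ← Complex.exp_add]
  convert one_mul _
  rw [Complex.exp_eq_one_iff]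
  exact ⟨0, by push_cast; ring⟩

variable {n : ℕ} {b : Fin n → ℂ}

omit [DecidableEq ι] in
theorem solM_eq_smul_solitonGram (hb : ∑ ℓ, (starRingEnd ℂ) (b ℓ) * b ℓ = 1)
    (hκs : ∀ j, star (κ j) = κ j) (p : ℝ × ℝ) :
    solM (fun j => I * κ j) (fun j ℓ => c j * b ℓ) p
      = I • solitonGram κ (stationaryPhase κ c p) := by
  ext j k
  have h1 : ∀ ℓ, (starRingEnd ℂ) (solBeta (fun j => I * κ j) (fun j ℓ => c j * b ℓ) p k ℓ)
      * solBeta (fun j => I * κ j) (fun j ℓ => c j * b ℓ) p j ℓ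
      = stationaryPhase κ c p j * star (stationaryPhase κ c p k)
        * ((starRingEnd ℂ) (b ℓ) * b ℓ) := by
    intro ℓ
    simp only [solBeta, stationaryPhase, map_mul, star_mul', Complex.star_def]
    ring
  have h2 : (starRingEnd ℂ) (I * κ j) - I * κ k = -I * (κ j + κ k) := by
    rw [map_mul, Complex.conj_I, show (starRingEnd ℂ) (κ j) = κ j from hκs j]
    ring
  simp only [solM, Matrix.of_apply, h1, ← Finset.mul_sum, hb, mul_one, h2, solitonGram,
    Matrix.smul_apply, smul_eq_mul]
  rw [div_eq_mul_inv, mul_inv, inv_neg, Complex.inv_I]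
  ring

theorem det_solB {lam : ι → ℂ} {bs : ι → Fin n → ℂ} {p : ℝ × ℝ}
    (hdet : (solM lam bs p).det ≠ 0) (ℓ : Fin n) :
    (solB lam bs ℓ p).det = -(solM lam bs p).det
      * ∑ k, ((solM lam bs p)⁻¹ *ᵥ fun j => solBeta lam bs p j ℓ) k := by
  set M := solM lam bs p with hM
  have hB : solB lam bs ℓ p = (Matrix.fromBlocks M
      (Matrix.replicateCol Unit fun j => solBeta lam bs p j ℓ)
      (Matrix.replicateRow Unit 1) 0).submatrix (Equiv.optionEquivSumPUnit ι)
      (Equiv.optionEquivSumPUnit ι) := by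
    ext i j
    cases i <;> cases j <;> simp [solB, hM]
  have : Invertible M := Matrix.invertibleOfIsUnitDet M (isUnit_iff_ne_zero.mpr hdet)
  rw [hB, Matrix.det_submatrix_equiv_self, Matrix.det_fromBlocks₁₁, Matrix.invOf_eq_nonsing_inv,
    Matrix.mul_assoc, ← Matrix.replicateCol_mulVec, Matrix.det_unique (n := Unit), Matrix.sub_apply,
    Matrix.replicateRow_mul_replicateCol_apply]
  simp [dotProduct]

theorem solR_eq (hb : ∑ ℓ, (starRingEnd ℂ) (b ℓ) * b ℓ = 1)
    (hκs : ∀ j, star (κ j) = κ j) {p : ℝ × ℝ}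
    (hdet : (solitonGram κ (stationaryPhase κ c p)).det ≠ 0) (ℓ : Fin n) :
    solR (fun j => I * κ j) (fun j ℓ => c j * b ℓ) p ℓ
      = -2 * (∑ k, ((solitonGram κ (stationaryPhase κ c p))⁻¹
        *ᵥ stationaryPhase κ c p) k) * b ℓ := by
  have hM := solM_eq_smul_solitonGram (c := c) hb hκs p
  have hdetM : (solM (fun j => I * κ j) (fun j ℓ => c j * b ℓ) p).det ≠ 0 := by
    rw [hM, Matrix.det_smul]
    exact mul_ne_zero (pow_ne_zero _ Complex.I_ne_zero) hdet
  have h1 : ((solM (fun j => I * κ j) (fun j ℓ => c j * b ℓ) p)⁻¹ *ᵥ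
      fun j => solBeta (fun j => I * κ j) (fun j ℓ => c j * b ℓ) p j ℓ)
      = (-I * b ℓ) • ((solitonGram κ (stationaryPhase κ c p))⁻¹ *ᵥ stationaryPhase κ c p) := by
    refine Matrix.mulVec_injective_of_det_ne_zero hdetM ?_
    rw [mulVec_inv_mulVec hdetM, hM, Matrix.mulVec_smul, Matrix.smul_mulVec,
      mulVec_inv_mulVec hdet, smul_smul]
    funext j
    simp only [solBeta, stationaryPhase, Pi.smul_apply, smul_eq_mul]
    linear_combination (b ℓ * Complex.exp (-2 * I * (I * κ j * p.1 + 2 * (I * κ j) ^ 2 * p.2))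
      * c j) * Complex.I_sq
  rw [solR, det_solB hdetM, h1]
  simp only [Pi.smul_apply, smul_eq_mul, ← Finset.mul_sum]
  field_simp
  linear_combination b ℓ * (∑ k, ((solitonGram κ (stationaryPhase κ c p))⁻¹
        *ᵥ stationaryPhase κ c p) k) * Complex.I_sq

theorem eventually_det_solitonGram_ne_zero (hκ : ∀ j k, κ j + κ k ≠ 0)
    (hκs : ∀ j, star (κ j) = κ j) {x t : ℝ}
    (hdet : (solitonGram κ (stationaryPhase κ c (x, t))).det ≠ 0) :
    ∀ᶠ y in nhds x, (solitonGram κ (stationaryPhase κ c (y, t))).det ≠ 0 :=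
  (differentiableAt_det fun j k => (hasDerivAt_solitonGram_of_x_flow hκ hκs
    (e := fun y => stationaryPhase κ c (y, t))
    (fun j => hasDerivAt_stationaryPhase_x x t j) j k).differentiableAt).continuousAt.eventually_ne
    hdet

theorem eventually_det_solitonGram_ne_zero_t {x t : ℝ}
    (hdet : (solitonGram κ (stationaryPhase κ c (x, t))).det ≠ 0) :
    ∀ᶠ y in nhds t, (solitonGram κ (stationaryPhase κ c (x, y))).det ≠ 0 :=
  (differentiableAt_det fun j k => ((((hasDerivAt_stationaryPhase_t x t j).mul
    (hasDerivAt_stationaryPhase_t x t k).star).add_const 1).mul_const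
    (κ j + κ k)⁻¹).differentiableAt).continuousAt.eventually_ne hdet

theorem pdx_solR (hb : ∑ ℓ, (starRingEnd ℂ) (b ℓ) * b ℓ = 1) (hκ : ∀ j k, κ j + κ k ≠ 0)
    (hκs : ∀ j, star (κ j) = κ j) {p : ℝ × ℝ}
    (hdet : (solitonGram κ (stationaryPhase κ c p)).det ≠ 0) (ℓ : Fin n) :
    pdx (fun q => solR (fun j => I * κ j) (fun j ℓ => c j * b ℓ) q ℓ) p
      = -2 * (-2 * (∑ k, κ k * ((solitonGram κ (stationaryPhase κ c p))⁻¹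
          *ᵥ stationaryPhase κ c p) k)
        + 2 * (∑ k, ((solitonGram κ (stationaryPhase κ c p))⁻¹ *ᵥ stationaryPhase κ c p) k)
          * ∑ k, ((solitonGram κ (stationaryPhase κ c p))⁻¹ *ᵥ 1) k) * b ℓ := by
  obtain ⟨x, t⟩ := p
  have h1 := HasDerivAt.fun_sum (u := Finset.univ) fun k _ =>
    hasDerivAt_solitonGram_inv_mulVec_of_x_flow hκ hκs
      (e := fun y => stationaryPhase κ c (y, t)) (fun j => hasDerivAt_stationaryPhase_x x t j)
      hdet k
  rw [Finset.sum_add_distrib, ← Finset.mul_sum, ← Finset.mul_sum] at h1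
  refine (((h1.const_mul (-2)).mul_const (b ℓ)).congr_of_eventuallyEq ?_).deriv
  filter_upwards [eventually_det_solitonGram_ne_zero hκ hκs hdet] with y hy
  exact solR_eq hb hκs hy ℓ

theorem vnls_solR (hb : ∑ ℓ, (starRingEnd ℂ) (b ℓ) * b ℓ = 1) (hκ : ∀ j k, κ j + κ k ≠ 0)
    (hκs : ∀ j, star (κ j) = κ j) {p : ℝ × ℝ}
    (hdet : (solitonGram κ (stationaryPhase κ c p)).det ≠ 0) :
    VNLS (fun q => solR (fun j => I * κ j) (fun j ℓ => c j * b ℓ) q) p := by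
  intro ℓ
  obtain ⟨x, t⟩ := p
  have hw := fun k => hasDerivAt_solitonGram_inv_mulVec_of_x_flow hκ hκs
    (e := fun y => stationaryPhase κ c (y, t)) (fun j => hasDerivAt_stationaryPhase_x x t j)
    hdet k
  have hv := fun k => hasDerivAt_solitonGram_inv_mulVec_one_of_x_flow hκ hκs
    (e := fun y => stationaryPhase κ c (y, t)) (fun j => hasDerivAt_stationaryPhase_x x t j)
    hdet k
  have ht := fun k => hasDerivAt_solitonGram_inv_mulVec_of_t_flow hκ hκs
    (e := fun y => stationaryPhase κ c (x, y)) (fun j => hasDerivAt_stationaryPhase_t x t j)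
    hdet rfl rfl k
  have hpdt := (((HasDerivAt.fun_sum (u := Finset.univ) fun k _ => ht k).const_mul
    (-2)).mul_const (b ℓ)).congr_of_eventuallyEq
    (f₁ := fun y => solR (fun j => I * κ j) (fun j ℓ => c j * b ℓ) (x, y) ℓ) (by
      filter_upwards [eventually_det_solitonGram_ne_zero_t hdet] with y hy
      exact solR_eq hb hκs hy ℓ)
  have hpdxx := (((((HasDerivAt.fun_sum (u := Finset.univ) fun k _ =>
    (hw k).const_mul (κ k)).const_mul (-2)).add
    (((HasDerivAt.fun_sum (u := Finset.univ) fun k _ => hw k).const_mul 2).mul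
    (HasDerivAt.fun_sum (u := Finset.univ) fun k _ => hv k))).const_mul
    (-2)).mul_const (b ℓ)).congr_of_eventuallyEq
    (f₁ := fun y => pdx (fun q => solR (fun j => I * κ j) (fun j ℓ => c j * b ℓ) q ℓ) (y, t)) (by
      filter_upwards [eventually_det_solitonGram_ne_zero hκ hκs hdet] with y hy
      exact pdx_solR hb hκ hκs hy ℓ)
  have hsq : ∑ j, (starRingEnd ℂ) (solR (fun j => I * κ j) (fun j ℓ => c j * b ℓ) (x, t) j)
      * solR (fun j => I * κ j) (fun j ℓ => c j * b ℓ) (x, t) j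
      = 4 * (star (∑ k, ((solitonGram κ (stationaryPhase κ c (x, t)))⁻¹
        *ᵥ stationaryPhase κ c (x, t)) k) * ∑ k, ((solitonGram κ (stationaryPhase κ c (x, t)))⁻¹
        *ᵥ stationaryPhase κ c (x, t)) k) := by
    rw [← mul_one (4 * _), ← hb, Finset.mul_sum]
    refine Finset.sum_congr rfl fun j _ => ?_
    rw [solR_eq hb hκs hdet]
    simp only [map_mul, map_neg, map_ofNat, Complex.star_def]
    ring
  beta_reduce
  rw [hsq, solR_eq hb hκs hdet, pdt, pdx, hpdt.deriv, hpdxx.deriv]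
  set w := (solitonGram κ (stationaryPhase κ c (x, t)))⁻¹ *ᵥ stationaryPhase κ c (x, t)
  set v := (solitonGram κ (stationaryPhase κ c (x, t)))⁻¹ *ᵥ 1
  have hs1 : ∑ k, κ k * (-2 * (κ k * w k) + 2 * (∑ k, w k) * v k)
      = -2 * ∑ k, κ k * (κ k * w k) + 2 * (∑ k, w k) * ∑ k, κ k * v k := by
    simp only [mul_add, mul_left_comm (κ _), Finset.sum_add_distrib, ← Finset.mul_sum]
  have hs2 : ∑ k, (-2 * (κ k * w k) + 2 * (∑ k, w k) * v k)
      = -2 * ∑ k, κ k * w k + 2 * (∑ k, w k) * ∑ k, v k := by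
    simp only [Finset.sum_add_distrib, ← Finset.mul_sum]
  rw [hs1, hs2]
  simp only [Finset.sum_add_distrib, Finset.sum_sub_distrib, ← Finset.mul_sum]
  linear_combination (-8 * b ℓ * (star (∑ k, w k) * (∑ k, w k) * (∑ k, w k)
    + ((∑ k, w k) * (∑ k, v k) - ∑ k, κ k * w k) * (∑ k, v k)
    + ∑ k, κ k * (κ k * w k) - (∑ k, w k) * ∑ k, κ k * v k)) * Complex.I_sq

end Stationary

end BoundSolitons

theorem stmt13 {n N : ℕ} (α : ℝ) (b : Fin n → ℂ)
    (hb : ∑ ℓ, (starRingEnd ℂ) (b ℓ) * b ℓ = 1)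
    (κ : Fin N → ℝ) (hκpos : ∀ j, 0 < κ j) (hκdist : Function.Injective κ)
    (hα : ∀ j, |α| < κ j)
    -- `f_α(iκⱼ) = (α+κⱼ)/(α−κⱼ) < 0`
    (hf : ∀ j, fRobin α (Complex.I * κ j) = (((α + κ j) / (α - κ j) : ℝ) : ℂ))
    -- the pure imaginary spectral parameters `λⱼ = iκⱼ`
    (lam : Fin N → ℂ) (hlam : lam = fun j => Complex.I * κ j)
    -- the norming vectors `b̃ⱼ = (√(−f_α(iκⱼ)))^{(−1)^N} b`
    (bt : Fin N → Fin n → ℂ)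
    (hbt : bt = fun j ℓ =>
      ((Real.sqrt (-((α + κ j) / (α - κ j))) ^ ((-1 : ℤ) ^ N) : ℝ) : ℂ) * b ℓ)
    (hdet : ∀ p : ℝ × ℝ, 0 ≤ p.1 → (solM lam bt p).det ≠ 0) :
    (∀ p : ℝ × ℝ, 0 ≤ p.1 → VNLS (fun q => solR lam bt q) p) ∧
      RobinBC α (fun q => solR lam bt q) := by
  subst hlam hbt
  set c : Fin N → ℂ := fun j =>
    ((Real.sqrt (-((α + κ j) / (α - κ j))) ^ ((-1 : ℤ) ^ N) : ℝ) : ℂ) with hc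
  have hκs : ∀ j, star ((κ j : ℂ)) = κ j := fun j => Complex.conj_ofReal _
  have hκ : ∀ j k, (κ j : ℂ) + κ k ≠ 0 := fun j k => by
    exact_mod_cast (add_pos (hκpos j) (hκpos k)).ne'
  have hG : ∀ p : ℝ × ℝ, 0 ≤ p.1 →
      (solitonGram (fun j => (κ j : ℂ)) (stationaryPhase (fun j => (κ j : ℂ)) c p)).det ≠ 0 := by
    intro p hp h0
    refine hdet p hp ?_
    rw [solM_eq_smul_solitonGram (κ := fun j => (κ j : ℂ)) (c := c) hb hκs p, Matrix.det_smul, h0,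
      mul_zero]
  refine ⟨fun p hp => vnls_solR (κ := fun j => (κ j : ℂ)) (c := c) hb hκ hκs (hG p hp), ?_⟩
  intro t ℓ
  have hdet0 := hG (0, t) le_rfl
  beta_reduce
  rw [pdx_solR (κ := fun j => (κ j : ℂ)) (c := c) hb hκ hκs hdet0,
    solR_eq (κ := fun j => (κ j : ℂ)) (c := c) hb hκs hdet0]
  have hcc := stationaryPhase_mul_star (κ := fun j => (κ j : ℂ)) (c := c) hκs t
  have htr := solitonGram_trace_identity hκ hdet0
  have hGw := mulVec_inv_mulVec hdet0
    (stationaryPhase (fun j => (κ j : ℂ)) c (0, t))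
  have hker := fun z => Matrix.eq_zero_of_mulVec_eq_zero (v := z) hdet0
  set e := stationaryPhase (fun j => (κ j : ℂ)) c (0, t)
  set w := (solitonGram (fun j => (κ j : ℂ)) e)⁻¹ *ᵥ e
  set v := (solitonGram (fun j => (κ j : ℂ)) e)⁻¹ *ᵥ 1
  obtain ⟨y, hy, hys⟩ := exists_isCauchyReflection hκpos hκdist
  have hw : ∀ j, e j * (cauchyGram (fun j => (κ j : ℂ)) *ᵥ (star e * w)) j
      + (cauchyGram (fun j => (κ j : ℂ)) *ᵥ w) j = e j := fun j => by
    rw [← solitonGram_mulVec, hGw]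
  have hP : ∀ z, (∀ j, e j * (cauchyGram (fun j => (κ j : ℂ)) *ᵥ (star e * z)) j
      + (cauchyGram (fun j => (κ j : ℂ)) *ᵥ z) j = 0) → z = 0 := fun z hz => hker z <| by
    funext j
    rw [solitonGram_mulVec, hz, Pi.zero_apply]
  have hrobin : ∑ j, ((κ j : ℂ) + α) * w j
      = (∑ j, w j) * (∑ j, y j - ∑ j, star (e j) * w j) := by
    have hpos : ∀ j, 0 < κ j - α ∧ 0 < κ j + α := fun j => by
      have := abs_lt.mp (hα j)
      constructor <;> linarith
    have hquot : ∀ j, Real.sqrt (-((α + κ j) / (α - κ j))) ^ 2 = (κ j + α) / (κ j - α) := by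
      intro j
      rw [← div_neg, neg_sub, add_comm, Real.sq_sqrt (div_pos (hpos j).2 (hpos j).1).le]
    have hα' : star (α : ℂ) = α := Complex.conj_ofReal _
    rcases Nat.even_or_odd N with hN | hN
    · refine hy.robin_of_even (by simpa using hN) hα' (fun j => ?_) hw hP
      rw [hcc, hc]
      simp only [hN.neg_one_pow, zpow_one, Complex.star_def, Complex.conj_ofReal]
      norm_cast
      rw [← sq, hquot, mul_div_cancel₀ _ (hpos j).1.ne']
    · refine hy.robin_of_odd (by simpa using hN) hα'
        (fun j => by exact_mod_cast (hpos j).1.ne') (fun j => by exact_mod_cast (hpos j).2.ne')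
        (fun j => ?_) hw hP
      rw [hcc, hc]
      simp only [hN.neg_one_pow, _root_.zpow_neg_one, Complex.star_def, Complex.conj_ofReal]
      norm_cast
      rw [← mul_inv, ← sq, hquot, inv_div, mul_div_cancel₀ _ (hpos j).2.ne']
  simp only [add_mul, Finset.sum_add_distrib, ← Finset.mul_sum] at hrobin
  linear_combination 4 * b ℓ * hrobin + 4 * b ℓ * (∑ j, w j) * (hys - htr)
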